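/- Let x₀ > 0 and θ > 0 be such that M_{x₀} < 2, and let σ ≤ 0. Then for every bounded continuous f : [x₀, ∞) → ℂ one has the bound ‖K_σ(f)‖_{L^∞(x₀,∞)} ≤ (M_{x₀}/2) · ‖f‖_{L^∞(x₀,∞)}; in particular K_σ is a contraction on the space of bounded continuous functions on [x₀, ∞). -/

import Mathlib

open MeasureTheory Set Filter Topology

noncomputable section

/-- The wave speed profile `c(x) = (1 + θ (x₊)^α)^(-1/2)`. -/
def spd (α θ x : ℝ) : ℝ := (1 + θ * (max x 0) ^ α) ^ (-(1 / 2) : ℝ)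

/-- The WKB amplitude `b(x) = c(x)^(1/2)`. -/
def amp (α θ x : ℝ) : ℝ := spd α θ x ^ ((1 : ℝ) / 2)

/-- The WKB phase `φ(x) = ∫₀ˣ c(y)⁻¹ dy`. -/
def phase (α θ x : ℝ) : ℝ := ∫ y in (0:ℝ)..x, (spd α θ y)⁻¹

/-- `M(x) = c(x)^(1/2) (c^(1/2))''(x)` for `x > 0`, and `0` for `x ≤ 0`. -/
def Mfun (α θ x : ℝ) : ℝ :=
  if 0 < x then
    spd α θ x ^ ((1 : ℝ) / 2) * deriv (deriv (fun y => spd α θ y ^ ((1 : ℝ) / 2))) x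
  else 0

/-- `M_{x₀} = ∫_{x₀}^∞ |M(x)| dx`. -/
def Mtail (α θ x₀ : ℝ) : ℝ := ∫ x in Ioi x₀, |Mfun α θ x|

/-- The Volterra operator `K_σ`. -/
def Kop (α θ x₀ σ : ℝ) (f : ℝ → ℂ) (x : ℝ) : ℂ :=
  (2 * Complex.I * (1 + Complex.I * (σ : ℂ)))⁻¹ *
    ((∫ y in x₀..x, (Mfun α θ y : ℂ) * f y *
        Complex.exp (-2 * Complex.I * (1 + Complex.I * (σ : ℂ)) *
          ((phase α θ x - phase α θ y : ℝ) : ℂ))) +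
      ∫ y in Ioi x, (Mfun α θ y : ℂ) * f y)

/-- The right-going WKB wave `v^> = b e^{-iφ}`. -/
def vplus (α θ x : ℝ) : ℂ := (amp α θ x : ℂ) * Complex.exp (-Complex.I * (phase α θ x : ℂ))

/-- The left-going WKB wave `v^< = b e^{iφ}`. -/
def vminus (α θ x : ℝ) : ℂ := (amp α θ x : ℂ) * Complex.exp (Complex.I * (phase α θ x : ℂ))

/-- `S` is a bounded continuous solution on `[x₀,∞)` of `S = e^{-2iφ} + K₀ S`. -/
def IsVolterraSol (α θ x₀ : ℝ) (S : ℝ → ℂ) : Prop :=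
  (∃ C, ∀ x ∈ Ici x₀, ‖S x‖ ≤ C) ∧ ContinuousOn S (Ici x₀) ∧
    ∀ x ∈ Ici x₀, S x = Complex.exp (-2 * Complex.I * (phase α θ x : ℂ)) + Kop α θ x₀ 0 S x

/-- `R_{x₀} = (2i)⁻¹ ∫_{x₀}^∞ M S^>`. -/
def Rx (α θ x₀ : ℝ) (S : ℝ → ℂ) : ℂ :=
  (2 * Complex.I)⁻¹ * ∫ x in Ioi x₀, (Mfun α θ x : ℂ) * S x

lemma one_le_one_add_mul_rpow (α : ℝ) {θ : ℝ} (hθ : 0 < θ) (x : ℝ) :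
    1 ≤ 1 + θ * (max x 0) ^ α :=
  le_add_of_nonneg_right (mul_nonneg hθ.le (Real.rpow_nonneg (le_max_right _ _) _))

lemma continuous_spd_inv {α θ : ℝ} (hα : 0 < α) (hθ : 0 < θ) :
    Continuous fun y => (spd α θ y)⁻¹ := by
  unfold spd
  have h : Continuous fun y : ℝ => 1 + θ * (max y 0) ^ α :=
    continuous_const.add (continuous_const.mul
      ((continuous_id.max continuous_const).rpow_const fun _ => Or.inr hα.le))
  have hpos (y : ℝ) : 0 < 1 + θ * (max y 0) ^ α :=
    zero_lt_one.trans_le (one_le_one_add_mul_rpow α hθ y)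
  exact (h.rpow_const fun y => Or.inl (hpos y).ne').inv₀
    fun y => (Real.rpow_pos_of_pos (hpos y) _).ne'

lemma continuous_phase {α θ : ℝ} (hα : 0 < α) (hθ : 0 < θ) : Continuous (phase α θ) :=
  intervalIntegral.continuous_primitive
    (fun _ _ => (continuous_spd_inv hα hθ).intervalIntegrable _ _) 0

lemma monotone_phase {α θ : ℝ} (hα : 0 < α) (hθ : 0 < θ) : Monotone (phase α θ) := by
  intro y x hyx
  have hi (a b : ℝ) : IntervalIntegrable (fun y => (spd α θ y)⁻¹) volume a b :=
    (continuous_spd_inv hα hθ).intervalIntegrable a b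
  rw [← sub_nonneg]
  unfold phase
  rw [intervalIntegral.integral_interval_sub_left (hi _ _) (hi _ _)]
  refine intervalIntegral.integral_nonneg hyx fun z _ => inv_nonneg.2 (Real.rpow_nonneg ?_ _)
  exact zero_le_one.trans (one_le_one_add_mul_rpow α hθ z)

lemma spd_rpow_half {α θ x : ℝ} (hθ : 0 < θ) (hx : 0 < x) :
    spd α θ x ^ ((1 : ℝ) / 2) = (1 + θ * x ^ α) ^ (-(1 / 4) : ℝ) := by
  have h := one_le_one_add_mul_rpow α hθ x
  rw [max_eq_left hx.le] at h
  rw [spd, max_eq_left hx.le, ← Real.rpow_mul (by linarith)]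
  norm_num

lemma hasDerivAt_one_add_mul_rpow_rpow {α θ x : ℝ} (p : ℝ) (hθ : 0 < θ) (hx : 0 < x) :
    HasDerivAt (fun y : ℝ => (1 + θ * y ^ α) ^ p)
      (θ * (α * x ^ (α - 1)) * p * (1 + θ * x ^ α) ^ (p - 1)) x := by
  have hu : 0 < 1 + θ * x ^ α := by positivity
  exact (((Real.hasDerivAt_rpow_const (p := α) (Or.inl hx.ne')).const_mul θ).const_add
    1).rpow_const (Or.inl hu.ne')

lemma Mfun_eq {α θ x : ℝ} (hθ : 0 < θ) (hx : 0 < x) :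
    Mfun α θ x = (1 + θ * x ^ α) ^ (-(1 / 4) : ℝ) * (-(θ * α / 4) *
      ((α - 1) * x ^ (α - 2) * (1 + θ * x ^ α) ^ (-(5 / 4) : ℝ) +
        x ^ (α - 1) * (θ * (α * x ^ (α - 1)) * (-(5 / 4)) *
          (1 + θ * x ^ α) ^ (-(9 / 4) : ℝ)))) := by
  have h1 : ∀ y : ℝ, 0 < y → deriv (fun y => spd α θ y ^ ((1 : ℝ) / 2)) y =
      -(θ * α / 4) * (y ^ (α - 1) * (1 + θ * y ^ α) ^ (-(5 / 4) : ℝ)) := by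
    intro y hy
    have he : (fun y => spd α θ y ^ ((1 : ℝ) / 2)) =ᶠ[𝓝 y]
        fun y => (1 + θ * y ^ α) ^ (-(1 / 4) : ℝ) := by
      filter_upwards [lt_mem_nhds hy] with z hz using spd_rpow_half hθ hz
    rw [he.deriv_eq, (hasDerivAt_one_add_mul_rpow_rpow _ hθ hy).deriv]
    norm_num
    ring
  have he : deriv (fun y => spd α θ y ^ ((1 : ℝ) / 2)) =ᶠ[𝓝 x]
      fun y => -(θ * α / 4) * (y ^ (α - 1) * (1 + θ * y ^ α) ^ (-(5 / 4) : ℝ)) := by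
    filter_upwards [lt_mem_nhds hx] with z hz using h1 z hz
  have hd : HasDerivAt
      (fun y : ℝ => -(θ * α / 4) * (y ^ (α - 1) * (1 + θ * y ^ α) ^ (-(5 / 4) : ℝ))) _ x :=
    ((Real.hasDerivAt_rpow_const (p := α - 1) (Or.inl hx.ne')).mul
      (hasDerivAt_one_add_mul_rpow_rpow (-(5 / 4)) hθ hx)).const_mul (-(θ * α / 4))
  rw [Mfun, if_pos hx, spd_rpow_half hθ hx, he.deriv_eq, hd.deriv,
    show α - 1 - 1 = α - 2 by ring, show (-(5 / 4) - 1 : ℝ) = -(9 / 4) by norm_num]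

lemma continuousOn_Mfun {α θ : ℝ} (hθ : 0 < θ) : ContinuousOn (Mfun α θ) (Ioi 0) := by
  refine ContinuousOn.congr ?_ fun x hx => Mfun_eq hθ hx
  have hr (p : ℝ) : ContinuousOn (fun x : ℝ => x ^ p) (Ioi 0) :=
    continuousOn_id.rpow_const fun x hx => Or.inl (ne_of_gt hx)
  have hu (p : ℝ) : ContinuousOn (fun x : ℝ => (1 + θ * x ^ α) ^ p) (Ioi 0) := by
    refine (continuousOn_const.add (continuousOn_const.mul (hr α))).rpow_const
      fun x hx => Or.inl ?_
    have := Real.rpow_pos_of_pos (mem_Ioi.1 hx) α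
    have : 0 < 1 + θ * x ^ α := by positivity
    exact this.ne'
  have := hr (α - 1)
  have := hr (α - 2)
  have := hu (-(1 / 4))
  have := hu (-(5 / 4))
  have := hu (-(9 / 4))
  fun_prop

lemma abs_Mfun_le {α θ x : ℝ} (hα : 0 < α) (hθ : 0 < θ) (hx : 0 < x) :
    |Mfun α θ x| ≤ (α / 4 * (|α - 1| + 5 / 4 * α)) * x ^ (-2 : ℝ) := by
  rw [Mfun_eq hθ hx]
  set u := 1 + θ * x ^ α with hu
  set w := θ * x ^ α with hw
  have hw0 : 0 < w := by positivity
  have hu1 : 1 ≤ u := by linarith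
  have hu0 : 0 < u := by linarith
  have hwu : w * u⁻¹ ≤ 1 := by
    rw [← div_eq_mul_inv]; exact (div_le_one hu0).2 (by linarith)
  have hwu0 : 0 ≤ w * u⁻¹ := by positivity
  have e1 : x ^ (α - 2) = x ^ α * x ^ (-2 : ℝ) := by rw [← Real.rpow_add hx]; rfl
  have e2 : x ^ (α - 1) * x ^ (α - 1) = x ^ α * x ^ α * x ^ (-2 : ℝ) := by
    rw [← Real.rpow_add hx, ← Real.rpow_add hx, ← Real.rpow_add hx]; ring_nf
  have e3 : u ^ (-(1 / 4) : ℝ) * u ^ (-(5 / 4) : ℝ) = u⁻¹ * u ^ (-(1 / 2) : ℝ) := by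
    rw [← Real.rpow_neg_one, ← Real.rpow_add hu0, ← Real.rpow_add hu0]; norm_num
  have e4 : u ^ (-(1 / 4) : ℝ) * u ^ (-(9 / 4) : ℝ) = u⁻¹ * u⁻¹ * u ^ (-(1 / 2) : ℝ) := by
    rw [← Real.rpow_neg_one, ← Real.rpow_add hu0, ← Real.rpow_add hu0, ← Real.rpow_add hu0]
    norm_num
  have hv1 : u ^ (-(1 / 2) : ℝ) ≤ 1 := Real.rpow_le_one_of_one_le_of_nonpos hu1 (by norm_num)
  have hv0 : 0 ≤ u ^ (-(1 / 2) : ℝ) := by positivity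
  have key : u ^ (-(1 / 4) : ℝ) * (-(θ * α / 4) *
      ((α - 1) * x ^ (α - 2) * u ^ (-(5 / 4) : ℝ) +
        x ^ (α - 1) * (θ * (α * x ^ (α - 1)) * (-(5 / 4)) * u ^ (-(9 / 4) : ℝ)))) =
      α / 4 * (u ^ (-(1 / 2) : ℝ) * (w * u⁻¹) *
        (-(α - 1) + 5 / 4 * α * (w * u⁻¹))) * x ^ (-2 : ℝ) := by
    rw [e1]
    linear_combination (-(θ * α / 4) * (α - 1) * x ^ α * x ^ (-2 : ℝ)) * e3 +
      (5 / 16 * θ ^ 2 * α ^ 2 * x ^ (α - 1) * x ^ (α - 1)) * e4 +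
      (5 / 16 * θ ^ 2 * α ^ 2 * u⁻¹ * u⁻¹ * u ^ (-(1 / 2) : ℝ)) * e2
  rw [key, abs_mul, abs_mul, abs_of_pos (show 0 < α / 4 by positivity),
    abs_of_pos (show 0 < x ^ (-2 : ℝ) by positivity)]
  gcongr
  rw [abs_mul, abs_of_nonneg (show 0 ≤ u ^ (-(1 / 2) : ℝ) * (w * u⁻¹) by positivity)]
  calc u ^ (-(1 / 2) : ℝ) * (w * u⁻¹) * |-(α - 1) + 5 / 4 * α * (w * u⁻¹)|
      ≤ 1 * |-(α - 1) + 5 / 4 * α * (w * u⁻¹)| := by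
        gcongr
        exact mul_le_one₀ hv1 hwu0 hwu
    _ ≤ |-(α - 1)| + |5 / 4 * α * (w * u⁻¹)| := by rw [one_mul]; exact abs_add_le _ _
    _ ≤ |α - 1| + 5 / 4 * α := by
        rw [abs_neg, abs_of_nonneg (show 0 ≤ 5 / 4 * α * (w * u⁻¹) by positivity)]
        exact add_le_add le_rfl (mul_le_of_le_one_right (by positivity) hwu)

lemma integrableOn_Mfun {α θ x₀ : ℝ} (hα : 0 < α) (hθ : 0 < θ) (hx₀ : 0 < x₀) :
    IntegrableOn (Mfun α θ) (Ioi x₀) := by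
  refine ((integrableOn_Ioi_rpow_of_lt (a := -2) (by norm_num) hx₀).const_mul
    (α / 4 * (|α - 1| + 5 / 4 * α))).mono' ?_ ?_
  · exact ((continuousOn_Mfun hθ).mono (Ioi_subset_Ioi hx₀.le)).aestronglyMeasurable
      measurableSet_Ioi
  · exact ae_restrict_of_forall_mem measurableSet_Ioi
      fun x hx => abs_Mfun_le hα hθ (hx₀.trans hx)

lemma norm_exp_phase_le_one {α θ σ x y : ℝ} (hα : 0 < α) (hθ : 0 < θ) (hσ : σ ≤ 0)
    (hyx : y ≤ x) :
    ‖Complex.exp (-2 * Complex.I * (1 + Complex.I * (σ : ℂ)) *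
      ((phase α θ x - phase α θ y : ℝ) : ℂ))‖ ≤ 1 := by
  rw [Complex.norm_exp, Real.exp_le_one_iff]
  have h : 0 ≤ phase α θ x - phase α θ y := sub_nonneg.2 (monotone_phase hα hθ hyx)
  rw [Complex.re_mul_ofReal]
  refine mul_nonpos_of_nonpos_of_nonneg ?_ h
  simp
  linarith

lemma norm_inv_prefactor_le (σ : ℝ) :
    ‖(2 * Complex.I * (1 + Complex.I * (σ : ℂ)))⁻¹‖ ≤ 1 / 2 := by
  have h : (1 : ℝ) ≤ ‖1 + Complex.I * (σ : ℂ)‖ := by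
    simpa using Complex.abs_re_le_norm (1 + Complex.I * (σ : ℂ))
  rw [norm_inv, norm_mul, norm_mul, Complex.norm_I, Complex.norm_ofNat, one_div]
  exact inv_anti₀ two_pos (by linarith)

/-- Sup-norm bound for `Kop`; no regularity of `f` is needed. -/
lemma norm_Kop_le {α θ x₀ σ C x : ℝ} (hα : 0 < α) (hθ : 0 < θ) (hx₀ : 0 < x₀) (hσ : σ ≤ 0)
    {f : ℝ → ℂ} (hf : ∀ y ∈ Ici x₀, ‖f y‖ ≤ C) (hx : x ∈ Ici x₀) :
    ‖Kop α θ x₀ σ f x‖ ≤ Mtail α θ x₀ / 2 * C := by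
  have hx' : x₀ ≤ x := hx
  have hM : IntegrableOn (fun y => |Mfun α θ y| * C) (Ioi x₀) :=
    ((integrableOn_Mfun hα hθ hx₀).abs).mul_const C
  have hMx : IntegrableOn (fun y => |Mfun α θ y| * C) (Ioi x) := hM.mono_set (Ioi_subset_Ioi hx')
  have hMi : IntervalIntegrable (fun y => |Mfun α θ y| * C) volume x₀ x :=
    (intervalIntegrable_iff_integrableOn_Ioc_of_le hx').2 (hM.mono_set Ioc_subset_Ioi_self)
  have h1 : ‖∫ y in x₀..x, (Mfun α θ y : ℂ) * f y *
        Complex.exp (-2 * Complex.I * (1 + Complex.I * (σ : ℂ)) *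
          ((phase α θ x - phase α θ y : ℝ) : ℂ))‖ ≤ ∫ y in x₀..x, |Mfun α θ y| * C := by
    refine intervalIntegral.norm_integral_le_of_norm_le hx' (ae_of_all _ fun y hy => ?_) hMi
    rw [norm_mul, norm_mul, Complex.norm_real, Real.norm_eq_abs]
    exact (mul_le_of_le_one_right (by positivity)
      (norm_exp_phase_le_one hα hθ hσ hy.2)).trans (by gcongr; exact hf y hy.1.le)
  have h2 : ‖∫ y in Ioi x, (Mfun α θ y : ℂ) * f y‖ ≤ ∫ y in Ioi x, |Mfun α θ y| * C := by
    refine norm_integral_le_of_norm_le hMx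
      (ae_restrict_of_forall_mem measurableSet_Ioi fun y hy => ?_)
    rw [norm_mul, Complex.norm_real, Real.norm_eq_abs]
    gcongr
    exact hf y (hx'.trans (le_of_lt hy))
  have h3 : (∫ y in x₀..x, |Mfun α θ y| * C) + ∫ y in Ioi x, |Mfun α θ y| * C =
      Mtail α θ x₀ * C := by
    rw [intervalIntegral.integral_interval_add_Ioi hM hMx, integral_mul_const, Mtail]
  rw [Kop, norm_mul]
  calc _ ≤ 1 / 2 * (Mtail α θ x₀ * C) := by
        gcongr
        · exact norm_inv_prefactor_le σ
        · rw [← h3]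
          exact (norm_add_le _ _).trans (add_le_add h1 h2)
    _ = _ := by ring

lemma integrableOn_Mfun_mul {α θ x₀ C : ℝ} (hα : 0 < α) (hθ : 0 < θ) (hx₀ : 0 < x₀)
    {f : ℝ → ℂ} (hfc : ContinuousOn f (Ici x₀)) (hf : ∀ y ∈ Ici x₀, ‖f y‖ ≤ C) :
    IntegrableOn (fun y => (Mfun α θ y : ℂ) * f y) (Ioi x₀) :=
  (integrableOn_Mfun hα hθ hx₀).ofReal.mul_bdd
    ((hfc.mono Ioi_subset_Ici_self).aestronglyMeasurable measurableSet_Ioi)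
    (ae_restrict_of_forall_mem measurableSet_Ioi fun y hy => hf y (Ioi_subset_Ici_self hy))

lemma Kop_sub {α θ x₀ σ Cf Cg x : ℝ} (hα : 0 < α) (hθ : 0 < θ) (hx₀ : 0 < x₀)
    {f g : ℝ → ℂ} (hfc : ContinuousOn f (Ici x₀)) (hgc : ContinuousOn g (Ici x₀))
    (hf : ∀ y ∈ Ici x₀, ‖f y‖ ≤ Cf) (hg : ∀ y ∈ Ici x₀, ‖g y‖ ≤ Cg) (hx : x ∈ Ici x₀) :
    Kop α θ x₀ σ (fun y => f y - g y) x = Kop α θ x₀ σ f x - Kop α θ x₀ σ g x := by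
  have hx' : x₀ ≤ x := hx
  have hif := integrableOn_Mfun_mul hα hθ hx₀ hfc hf
  have hig := integrableOn_Mfun_mul hα hθ hx₀ hgc hg
  have hE : Continuous fun y => Complex.exp (-2 * Complex.I * (1 + Complex.I * (σ : ℂ)) *
      ((phase α θ x - phase α θ y : ℝ) : ℂ)) := by
    have := continuous_phase hα hθ
    fun_prop
  have hii {h : ℝ → ℂ} (hh : IntegrableOn h (Ioi x₀)) : IntervalIntegrable h volume x₀ x :=
    (intervalIntegrable_iff_integrableOn_Ioc_of_le hx').2 (hh.mono_set Ioc_subset_Ioi_self)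
  have hsub := Ioi_subset_Ioi hx'
  simp only [Kop, mul_sub, sub_mul]
  rw [intervalIntegral.integral_sub ((hii hif).mul_continuousOn hE.continuousOn)
    ((hii hig).mul_continuousOn hE.continuousOn),
    integral_sub (hif.mono_set hsub) (hig.mono_set hsub)]
  ring

/-- `K_σ` is bounded by `M_{x₀}/2` in sup norm, hence a contraction. -/
theorem stmt2 (α θ x₀ σ : ℝ) (hα : 0 < α) (hθ : 0 < θ) (hx₀ : 0 < x₀)
    (hM : Mtail α θ x₀ < 2) (hσ : σ ≤ 0) :
    (∀ f : ℝ → ℂ, ContinuousOn f (Ici x₀) → ∀ C : ℝ, (∀ x ∈ Ici x₀, ‖f x‖ ≤ C) →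
      ∀ x ∈ Ici x₀, ‖Kop α θ x₀ σ f x‖ ≤ Mtail α θ x₀ / 2 * C) ∧
    (∀ f g : ℝ → ℂ, ContinuousOn f (Ici x₀) → ContinuousOn g (Ici x₀) →
      (∃ C, ∀ x ∈ Ici x₀, ‖f x‖ ≤ C) → (∃ C, ∀ x ∈ Ici x₀, ‖g x‖ ≤ C) →
      ∀ C : ℝ, (∀ x ∈ Ici x₀, ‖f x - g x‖ ≤ C) →
      ∀ x ∈ Ici x₀, ‖Kop α θ x₀ σ f x - Kop α θ x₀ σ g x‖ ≤ Mtail α θ x₀ / 2 * C) := by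
  refine ⟨fun f _ C hf x hx => norm_Kop_le hα hθ hx₀ hσ hf hx, ?_⟩
  rintro f g hfc hgc ⟨Cf, hf⟩ ⟨Cg, hg⟩ C hfg x hx
  rw [← Kop_sub hα hθ hx₀ hfc hgc hf hg hx]
  exact norm_Kop_le hα hθ hx₀ hσ hfg hx
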